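/- arXiv:2204.07016 — 4 statements merged into one kernel-verified Lean document; each statement's English description precedes it below -/
import Mathlib

section
/- (Pathwise version of Remark 4.3.) If τ_B < ∞, then for every t ≥ τ_B one has X_t = Y_t − sup_{0≤s≤t} (Y_s − B)⁺, where (z)⁺ = max(z, 0); that is, after τ_B the process X coincides with the Skorokhod reflection of Y at the barrier B. -/
open MeasureTheory Set

/-- A function vanishing at `0` with derivative decreasing on `[0, B]` has secant slopes between
its derivatives at the two ends. -/
lemma mul_deriv_le_and_le_of_antitoneOn {g g' : ℝ → ℝ} {B : ℝ}
    (hg : ∀ y, HasDerivAt g (g' y) y) (hg0 : g 0 = 0) (hanti : AntitoneOn g' (Icc 0 B))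
    {y : ℝ} (hy : y ∈ Ioc 0 B) : y * g' y ≤ g y ∧ g y ≤ y * g' 0 := by
  obtain ⟨ξ, hξ, h⟩ := exists_hasDerivAt_eq_slope g g' hy.1
    (fun z _ => (hg z).continuousAt.continuousWithinAt) (fun z _ => hg z)
  have hξB : ξ ∈ Icc 0 B := ⟨hξ.1.le, hξ.2.le.trans hy.2⟩
  have heq : g y = y * g' ξ := by
    have := hy.1.ne'
    rw [h, hg0]
    field_simp
    ring
  rw [heq]
  exact ⟨mul_le_mul_of_nonneg_left (hanti hξB ⟨hy.1.le, hy.2⟩ hξ.2.le) hy.1.le,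
    mul_le_mul_of_nonneg_left (hanti ⟨le_rfl, hy.1.le.trans hy.2⟩ hξB hξ.1.le) hy.1.le⟩

/-- For `g` increasing, vanishing at `0` and concave on `[0, B]`, the function
`y ↦ g y / (y * g' y) - 1` is nonnegative and integrable on `(0, B]`. -/
lemma nonneg_and_intervalIntegrable_of_antitoneOn {g g' lam : ℝ → ℝ} {B : ℝ} (hB : 0 < B)
    (hg : ∀ y, HasDerivAt g (g' y) y) (hg0 : g 0 = 0) (hanti : AntitoneOn g' (Icc 0 B))
    (hcont : Continuous g') (hpos : ∀ y, 0 < g' y)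
    (hlam : ∀ y ∈ Ioc 0 B, lam y = g y / (y * g' y) - 1) :
    (∀ y ∈ Ioc 0 B, 0 ≤ lam y) ∧ IntervalIntegrable lam volume 0 B := by
  have hnonneg : ∀ y ∈ Ioc 0 B, 0 ≤ lam y := fun y hy => by
    rw [hlam y hy, sub_nonneg, one_le_div (mul_pos hy.1 (hpos y))]
    exact (mul_deriv_le_and_le_of_antitoneOn hg hg0 hanti hy).1
  refine ⟨hnonneg, ?_⟩
  have hgc : Continuous g := continuous_iff_continuousAt.2 fun y => (hg y).continuousAt
  have hlamc : ContinuousOn lam (Ioc 0 B) := by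
    refine ContinuousOn.congr ?_ hlam
    exact (hgc.continuousOn.div (continuous_id.mul hcont).continuousOn
      (fun y hy => (mul_pos hy.1 (hpos y)).ne')).sub continuousOn_const
  rw [intervalIntegrable_iff_integrableOn_Ioc_of_le hB.le]
  refine IntegrableOn.of_bound measure_Ioc_lt_top
    (hlamc.aestronglyMeasurable measurableSet_Ioc) (g' 0 / g' B) ?_
  refine (ae_restrict_iff' measurableSet_Ioc).2 (.of_forall fun y hy => ?_)
  rw [Real.norm_of_nonneg (hnonneg y hy), hlam y hy]
  have hslope : g y / (y * g' y) ≤ g' 0 / g' B := by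
    rw [div_le_div_iff₀ (mul_pos hy.1 (hpos y)) (hpos B)]
    calc g y * g' B ≤ y * g' 0 * g' y := mul_le_mul
          (mul_deriv_le_and_le_of_antitoneOn hg hg0 hanti hy).2
          (hanti ⟨hy.1.le, hy.2⟩ ⟨hB.le, le_rfl⟩ hy.2) (hpos B).le
          (mul_pos hy.1 (hpos 0)).le
      _ = g' 0 * (y * g' y) := by ring
  linarith

lemma roots_sign_and_lt {μ σ r : ℝ} (hμ : 0 < μ) (hσ : 0 < σ) (hr : 0 < r) :
    (-μ - √(μ ^ 2 + 2 * r * σ ^ 2)) / σ ^ 2 < 0 ∧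
    0 < (-μ + √(μ ^ 2 + 2 * r * σ ^ 2)) / σ ^ 2 ∧
    (-μ + √(μ ^ 2 + 2 * r * σ ^ 2)) / σ ^ 2 < -((-μ - √(μ ^ 2 + 2 * r * σ ^ 2)) / σ ^ 2) := by
  have hσ2 : 0 < σ ^ 2 := by positivity
  have hsqrt : μ < √(μ ^ 2 + 2 * r * σ ^ 2) := Real.lt_sqrt_of_sq_lt (by
    have : 0 < 2 * r * σ ^ 2 := by positivity
    linarith)
  refine ⟨div_neg_of_neg_of_pos (by linarith) hσ2, div_pos (by linarith) hσ2, ?_⟩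
  rw [← neg_div]
  exact div_lt_div_of_pos_right (by linarith) hσ2

lemma hasDerivAt_exp_sub_exp_div (a d y : ℝ) :
    HasDerivAt (fun y => (Real.exp (d * y) - Real.exp (a * y)) / (d - a))
      ((d * Real.exp (d * y) - a * Real.exp (a * y)) / (d - a)) y := by
  have h (k : ℝ) : HasDerivAt (fun y => Real.exp (k * y)) (k * Real.exp (k * y)) y := by
    simpa [mul_comm] using ((hasDerivAt_id y).const_mul k).exp
  exact ((h d).sub (h a)).div_const _

lemma antitoneOn_deriv_exp_sub_exp_div {a d B : ℝ} (ha : a < 0) (hd : 0 < d)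
    (hB : B = (Real.log (a ^ 2) - Real.log (d ^ 2)) / (d - a)) :
    AntitoneOn (fun y => (d * Real.exp (d * y) - a * Real.exp (a * y)) / (d - a)) (Iic B) := by
  have hda : 0 < d - a := by linarith
  have h (k y : ℝ) : HasDerivAt (fun y => k * Real.exp (k * y)) (k * (k * Real.exp (k * y))) y := by
    simpa [mul_comm] using (((hasDerivAt_id y).const_mul k).exp).const_mul k
  have hderiv (y : ℝ) := ((h d y).sub (h a y)).div_const (d - a)
  refine antitoneOn_of_hasDerivWithinAt_nonpos (convex_Iic B)
    (fun y _ => (hderiv y).continuousAt.continuousWithinAt)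
    (fun y _ => (hderiv y).hasDerivWithinAt) fun y hy => ?_
  rw [interior_Iic, mem_Iio, hB, lt_div_iff₀ hda] at hy
  refine div_nonpos_of_nonpos_of_nonneg ?_ hda.le
  have key : Real.exp (Real.log (d ^ 2) + d * y) ≤ Real.exp (Real.log (a ^ 2) + a * y) :=
    Real.exp_le_exp.2 (by linarith)
  rw [Real.exp_add, Real.exp_add, Real.exp_log (by positivity),
    Real.exp_log (sq_pos_of_neg ha)] at key
  linarith

/-- If a continuous path takes values at least `M` at nonnegative times arbitrarily close to, or
before, `t`, then it does so at some time in `[0, t]`. -/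
lemma exists_mem_Icc_le_of_forall_gt {Y : ℝ → ℝ} (hY : Continuous Y) {M t : ℝ} (ht : 0 ≤ t)
    (h : ∀ u, t < u → ∃ s, 0 ≤ s ∧ s < u ∧ M ≤ Y s) : ∃ s ∈ Icc 0 t, M ≤ Y s := by
  by_contra! hlt
  obtain ⟨ε, hε, hball⟩ := Metric.eventually_nhds_iff.1
    (hY.continuousAt.eventually_lt_const (hlt t ⟨ht, le_rfl⟩))
  obtain ⟨s, hs0, hs, hMs⟩ := h (t + ε) (by linarith)
  rcases le_or_gt s t with hst | hst
  · exact (hlt s ⟨hs0, hst⟩).not_ge hMs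
  · refine (hball ?_).not_ge hMs
    rw [Real.dist_eq, abs_of_pos (by linarith)]
    linarith

lemma sSup_image_max_sub_zero {Y : ℝ → ℝ} {s : Set ℝ} {B : ℝ} (hs : s.Nonempty)
    (hbdd : BddAbove (Y '' s)) (hB : B ≤ sSup (Y '' s)) :
    sSup ((fun u => max (Y u - B) 0) '' s) = sSup (Y '' s) - B := by
  refine le_antisymm (csSup_le (hs.image _) ?_) ?_
  · rintro _ ⟨u, hu, rfl⟩
    exact max_le (by linarith [le_csSup hbdd (mem_image_of_mem Y hu)]) (by linarith)
  · rw [sub_le_iff_le_add]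
    have hbdd' : BddAbove ((fun u => max (Y u - B) 0) '' s) := by
      refine ⟨sSup (Y '' s) - B, ?_⟩
      rintro _ ⟨u, hu, rfl⟩
      exact max_le (by linarith [le_csSup hbdd (mem_image_of_mem Y hu)]) (by linarith)
    refine csSup_le (hs.image _) ?_
    rintro _ ⟨u, hu, rfl⟩
    have h := le_csSup hbdd' (mem_image_of_mem (fun u => max (Y u - B) 0) hu)
    linarith [le_max_left (Y u - B) 0]

/-- pathwise version of Remark 4.3. If the hitting time `τ_B` of `B` by
`X_t = Y_t − Ȳ_t + f(Ȳ_t)` is finite, then for every `t ≥ τ_B` one has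
`X_t = Y_t − sup_{0≤s≤t} (Y_s − B)⁺`; i.e. after `τ_B` the process `X` coincides with the
Skorokhod reflection of `Y` at the barrier `B`. -/
theorem deFinetti_perturbed_BM_reflection_after_tauB
    (μ σ r : ℝ) (hμ : 0 < μ) (hσ : 0 < σ) (hr : 0 < r)
    (ζ₁ ζ₂ : ℝ)
    (hζ₁ : ζ₁ = (-μ - Real.sqrt (μ ^ 2 + 2 * r * σ ^ 2)) / σ ^ 2)
    (hζ₂ : ζ₂ = (-μ + Real.sqrt (μ ^ 2 + 2 * r * σ ^ 2)) / σ ^ 2)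
    (ψ : ℝ → ℝ)
    (hψ : ∀ y : ℝ, ψ y = (Real.exp (ζ₂ * y) - Real.exp (ζ₁ * y)) / (ζ₂ - ζ₁))
    (B : ℝ) (hB : B = (Real.log (ζ₁ ^ 2) - Real.log (ζ₂ ^ 2)) / (ζ₂ - ζ₁))
    (V : ℝ → ℝ)
    (hV₁ : ∀ y : ℝ, y ≤ B → V y = ψ y / deriv ψ B)
    (hV₂ : ∀ y : ℝ, B < y → V y = y - B + V B)
    (c : ℝ → ℝ)
    (hc₁ : ∀ y : ℝ, 0 ≤ y → y ≤ B → c y = (deriv V y - 1) / deriv V y)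
    (hc₂ : ∀ y : ℝ, B < y → c y = 0)
    (phat : ℝ) (hphat : phat = (deriv V 0 - 1) / deriv V 0)
    (b : ℝ → ℝ)
    (hb₁ : ∀ q : ℝ, 0 ≤ q → q ≤ phat → b q ∈ Set.Icc 0 B ∧ c (b q) = q)
    (hb₂ : ∀ q : ℝ, phat < q → q ≤ 1 → b q = 0)
    (lam : ℝ → ℝ)
    (hlam : ∀ y : ℝ, 0 < y → y ≤ B → lam y = ψ y / (y * deriv ψ y) - 1)
    (p : ℝ) (hp : p ∈ Set.Icc (0 : ℝ) 1)
    (Lam : ℝ → ℝ)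
    (hLam : ∀ y : ℝ, b p ≤ y → y ≤ B → Lam y = ∫ z in (b p)..y, lam z)
    (f : ℝ → ℝ)
    (hf₁ : ∀ y : ℝ, b p ≤ y → y ≤ Lam B + B →
      f y ∈ Set.Icc (b p) B ∧ Lam (f y) + f y = y)
    (hf₂ : ∀ y : ℝ, Lam B + B < y → f y = B)
    (x : ℝ) (hx : x ∈ Set.Icc 0 (b p))
    (Y : ℝ → ℝ) (hYcont : Continuous Y) (hY0 : Y 0 = x)
    (Ybar : ℝ → ℝ)
    (hYbar : ∀ t : ℝ, Ybar t = max (b p) (sSup (Y '' Set.Icc 0 t)))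
    (X : ℝ → ℝ)
    (hX : ∀ t : ℝ, X t = Y t - Ybar t + f (Ybar t))
    (τB : ENNReal)
    (hτB : τB = ⨅ (t : ℝ) (_ : 0 ≤ t ∧ B ≤ X t), ENNReal.ofReal t)
    (hfin : τB ≠ ⊤) :
    ∀ t : ℝ, 0 ≤ t → τB ≤ ENNReal.ofReal t →
      X t = Y t - sSup ((fun s => max (Y s - B) 0) '' Set.Icc 0 t) := by
  obtain ⟨hζ₁neg, hζ₂pos, hζlt⟩ := roots_sign_and_lt hμ hσ hr
  rw [← hζ₁] at hζ₁neg hζlt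
  rw [← hζ₂] at hζ₂pos hζlt
  have hζ : 0 < ζ₂ - ζ₁ := by linarith
  have hBpos : 0 < B := by
    rw [hB]
    refine div_pos (sub_pos.2 (Real.log_lt_log (by positivity) ?_)) hζ
    nlinarith
  have hψ' (y : ℝ) := hasDerivAt_exp_sub_exp_div ζ₁ ζ₂ y
  rw [← funext hψ] at hψ'
  have hanti := (antitoneOn_deriv_exp_sub_exp_div hζ₁neg hζ₂pos hB).mono
    (Icc_subset_Iic_self : Icc 0 B ⊆ Iic B)
  have hψ'pos (y : ℝ) :
      0 < (ζ₂ * Real.exp (ζ₂ * y) - ζ₁ * Real.exp (ζ₁ * y)) / (ζ₂ - ζ₁) := by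
    have h₁ := mul_neg_of_neg_of_pos hζ₁neg (Real.exp_pos (ζ₁ * y))
    have h₂ := mul_pos hζ₂pos (Real.exp_pos (ζ₂ * y))
    exact div_pos (by linarith) hζ
  obtain ⟨hlam0, hlamint⟩ := nonneg_and_intervalIntegrable_of_antitoneOn (lam := lam) hBpos hψ'
    (by simp [hψ]) hanti (by fun_prop)
    hψ'pos
    (fun y hy => by rw [hlam y hy.1 hy.2, (hψ' y).deriv])
  have hb : b p ∈ Icc 0 B := by
    rcases le_or_gt p phat with h | h
    · exact (hb₁ p hp.1 h).1
    · rw [hb₂ p h hp.2]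
      exact ⟨le_rfl, hBpos.le⟩
  have hLam_mono : ∀ z ∈ Icc (b p) B, Lam z ≤ Lam B := fun z hz => by
    rw [hLam z hz.1 hz.2, hLam B hb.2 le_rfl]
    refine intervalIntegral.integral_mono_interval le_rfl hz.1 hz.2 ?_
      (hlamint.mono_set ?_)
    · exact (ae_restrict_iff' measurableSet_Ioc).2
        (.of_forall fun y hy => hlam0 y ⟨hb.1.trans_lt hy.1, hy.2⟩)
    · rw [uIcc_of_le hb.2, uIcc_of_le hBpos.le]
      exact Icc_subset_Icc_left hb.1
  have hLamB : 0 ≤ Lam B := by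
    simpa [hLam (b p) le_rfl hb.2] using hLam_mono (b p) ⟨le_rfl, hb.2⟩
  have hf_top : ∀ y, Lam B + B ≤ y → f y = B := fun y hy => by
    rcases hy.eq_or_lt with rfl | hy
    · obtain ⟨hmem, heq⟩ := hf₁ (Lam B + B) (by linarith [hb.2]) le_rfl
      linarith [hLam_mono _ hmem, hmem.2]
    · exact hf₂ y hy
  have hf_le : ∀ y, b p ≤ y → f y ≤ B := fun y hy => by
    rcases le_or_gt y (Lam B + B) with h | h
    · exact (hf₁ y hy h).1.2
    · exact (hf₂ y h).le
  have hbdd (t : ℝ) : BddAbove (Y '' Icc 0 t) := (isCompact_Icc.image hYcont).bddAbove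
  have hYle : ∀ s, 0 ≤ s → Y s ≤ Ybar s := fun s hs => by
    rw [hYbar]
    exact (le_csSup (hbdd s) (mem_image_of_mem Y ⟨hs, le_rfl⟩)).trans (le_max_right _ _)
  have hhit : ∀ s, 0 ≤ s → B ≤ X s → Lam B + B ≤ Y s := fun s hs hXs => by
    have hbs : b p ≤ Ybar s := by
      rw [hYbar]
      exact le_max_left _ _
    have hfs := hf_le _ hbs
    have hYs := hYle s hs
    rw [hX] at hXs
    have hYeq : Y s = Ybar s := by linarith
    rw [hYeq]
    by_contra! hlt
    obtain ⟨-, heq⟩ := hf₁ _ hbs hlt.le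
    rw [show f (Ybar s) = B by linarith] at heq
    linarith
  intro t ht hτt
  obtain ⟨s, hs, hMs⟩ := exists_mem_Icc_le_of_forall_gt (M := Lam B + B) hYcont ht fun u hu => by
    have hlt : τB < ENNReal.ofReal u :=
      hτt.trans_lt ((ENNReal.ofReal_lt_ofReal_iff (ht.trans_lt hu)).2 hu)
    simp only [hτB, iInf_lt_iff] at hlt
    obtain ⟨s, ⟨hs0, hXs⟩, hsu⟩ := hlt
    exact ⟨s, hs0, (ENNReal.ofReal_lt_ofReal_iff (ht.trans_lt hu)).1 hsu, hhit s hs0 hXs⟩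
  have hsup : Lam B + B ≤ sSup (Y '' Icc 0 t) :=
    hMs.trans (le_csSup (hbdd t) (mem_image_of_mem Y hs))
  have hYbart : Ybar t = sSup (Y '' Icc 0 t) := by
    rw [hYbar, max_eq_right]
    linarith [hb.2]
  rw [sSup_image_max_sub_zero (nonempty_Icc.2 ht) (hbdd t) (by linarith), hX, hYbart,
    hf_top _ hsup]
  ring
end

section
/- For every x ∈ (0,B), writing p = c(x) (so that x = b(p)): the partial derivative of u in x satisfies u_x(x, c(x)) = x ψ'(x)/ψ(x); b is differentiable at p with b'(p) = 1/c'(x) and the partial derivative of u in p satisfies u_p(x, c(x)) = (ψ(x) − x ψ'(x))/(ψ(x) c'(x)); consequently c'(x) u_p(x, c(x)) / u_x(x, c(x)) = (ψ(x) − x ψ'(x))/(x ψ'(x)) = λ(x). -/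
open Set Filter Topology

theorem hasStrictDerivAt_one_sub_div {h : ℝ → ℝ} {h' k x : ℝ} (hh : HasStrictDerivAt h h' x)
    (h0 : h x ≠ 0) : HasStrictDerivAt (fun y => 1 - k / h y) (k * h' / h x ^ 2) x := by
  have := ((hasStrictDerivAt_const x k).div hh h0).const_sub 1
  refine this.congr_deriv ?_
  ring

theorem hasStrictDerivAt_exp_const_mul (a y : ℝ) :
    HasStrictDerivAt (fun y => Real.exp (a * y)) (a * Real.exp (a * y)) y := by
  have := (((hasStrictDerivAt_id y).const_mul a)).exp
  refine this.congr_deriv ?_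
  simp [mul_comm]

theorem sq_mul_exp_lt_sq_mul_exp {a b y : ℝ} (ha : a ≠ 0) (hb : b ≠ 0) (hab : a < b)
    (hy : y < (Real.log (a ^ 2) - Real.log (b ^ 2)) / (b - a)) :
    b ^ 2 * Real.exp (b * y) < a ^ 2 * Real.exp (a * y) := by
  have ha2 : 0 < a ^ 2 := by positivity
  have hb2 : 0 < b ^ 2 := by positivity
  rw [lt_div_iff₀ (sub_pos.2 hab)] at hy
  rw [← Real.exp_log ha2, ← Real.exp_log hb2, ← Real.exp_add, ← Real.exp_add, Real.exp_lt_exp]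
  linarith

/-- If `f` agrees with `g` on `(-∞, B]` and is affine of slope `m` on `(B, ∞)`, continuing `g`
with its own slope `m` at `B`, then `f` has derivative `m` at `B`. -/
theorem hasDerivAt_of_affine_continuation {f g : ℝ → ℝ} {m B : ℝ} (hg : HasDerivAt g m B)
    (hle : ∀ y ≤ B, f y = g y) (hlt : ∀ y, B < y → f y = m * (y - B) + f B) :
    HasDerivAt f m B := by
  have hl : HasDerivWithinAt f m (Iic B) B := hg.hasDerivWithinAt.congr hle (hle B le_rfl)
  have haff : HasDerivAt (fun y => m * (y - B) + f B) m B := by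
    simpa using (((hasDerivAt_id B).sub_const B).const_mul m).add_const (f B)
  have hr : HasDerivWithinAt f m (Ici B) B := by
    refine haff.hasDerivWithinAt.congr (fun y hy => ?_) (by simp)
    rcases eq_or_lt_of_le (mem_Ici.1 hy) with rfl | h
    · simp
    · exact hlt y h
  simpa [Iic_union_Ici] using hl.union hr


/-- For `x ∈ (0,B)`, writing `p = c(x)` (so `x = b(p)`): the partial
derivative of `u` in `x` (from the left, `u` being defined for `x ≤ b(p)`) satisfies
`u_x(x, c(x)) = x ψ'(x)/ψ(x)`; `b` is differentiable at `p` with `b'(p) = 1/c'(x)` and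
`u_p(x, c(x)) = (ψ(x) − x ψ'(x))/(ψ(x) c'(x))`; consequently
`c'(x) u_p(x,c(x)) / u_x(x,c(x)) = (ψ(x) − x ψ'(x))/(x ψ'(x)) = λ(x)`. -/
theorem deFinetti_reflection_direction
    (μ σ r : ℝ) (hμ : 0 < μ) (hσ : 0 < σ) (hr : 0 < r)
    (ζ₁ ζ₂ : ℝ)
    (hζ₁ : ζ₁ = (-μ - Real.sqrt (μ ^ 2 + 2 * r * σ ^ 2)) / σ ^ 2)
    (hζ₂ : ζ₂ = (-μ + Real.sqrt (μ ^ 2 + 2 * r * σ ^ 2)) / σ ^ 2)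
    (ψ : ℝ → ℝ)
    (hψ : ∀ y : ℝ, ψ y = (Real.exp (ζ₂ * y) - Real.exp (ζ₁ * y)) / (ζ₂ - ζ₁))
    (B : ℝ) (hB : B = (Real.log (ζ₁ ^ 2) - Real.log (ζ₂ ^ 2)) / (ζ₂ - ζ₁))
    (V : ℝ → ℝ)
    (hV₁ : ∀ y : ℝ, y ≤ B → V y = ψ y / deriv ψ B)
    (hV₂ : ∀ y : ℝ, B < y → V y = y - B + V B)
    (c : ℝ → ℝ)
    (hc₁ : ∀ y : ℝ, 0 ≤ y → y ≤ B → c y = (deriv V y - 1) / deriv V y)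
    (hc₂ : ∀ y : ℝ, B < y → c y = 0)
    (phat : ℝ) (hphat : phat = (deriv V 0 - 1) / deriv V 0)
    (b : ℝ → ℝ)
    (hb₁ : ∀ q : ℝ, 0 ≤ q → q ≤ phat → b q ∈ Set.Icc 0 B ∧ c (b q) = q)
    (hb₂ : ∀ q : ℝ, phat < q → q ≤ 1 → b q = 0)
    (lam : ℝ → ℝ)
    (hlam : ∀ y : ℝ, 0 < y → y ≤ B → lam y = ψ y / (y * deriv ψ y) - 1)
    (u : ℝ → ℝ → ℝ)
    (hu : ∀ x q : ℝ, 0 < x → x ≤ b q → 0 < q → q < phat →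
      u x q = b q * ψ x / ψ (b q)) :
    ∀ x ∈ Set.Ioo (0 : ℝ) B,
      derivWithin (fun z => u z (c x)) (Set.Iic (b (c x))) x = x * deriv ψ x / ψ x ∧
      HasDerivAt b (1 / deriv c x) (c x) ∧
      derivWithin (fun q => u x q) (Set.Iic (c x)) (c x)
        = (ψ x - x * deriv ψ x) / (ψ x * deriv c x) ∧
      deriv c x * derivWithin (fun q => u x q) (Set.Iic (c x)) (c x)
          / derivWithin (fun z => u z (c x)) (Set.Iic (b (c x))) x
        = (ψ x - x * deriv ψ x) / (x * deriv ψ x) ∧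
      (ψ x - x * deriv ψ x) / (x * deriv ψ x) = lam x := by
  have hσ2 : 0 < σ ^ 2 := by positivity
  have hsqrt : μ < Real.sqrt (μ ^ 2 + 2 * r * σ ^ 2) := by
    refine Real.lt_sqrt_of_sq_lt ?_
    have : 0 < 2 * r * σ ^ 2 := by positivity
    linarith
  have hneg : ζ₁ < 0 := by
    rw [hζ₁]
    exact div_neg_of_neg_of_pos (by linarith) hσ2
  have hpos : 0 < ζ₂ := by
    rw [hζ₂]
    exact div_pos (by linarith) hσ2
  have hlt : ζ₁ < ζ₂ := hneg.trans hpos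
  have hsub : 0 < ζ₂ - ζ₁ := sub_pos.2 hlt
  obtain ⟨d, hd⟩ : ∃ d : ℝ → ℝ, d = fun y =>
    (ζ₂ * Real.exp (ζ₂ * y) - ζ₁ * Real.exp (ζ₁ * y)) / (ζ₂ - ζ₁) := ⟨_, rfl⟩
  obtain ⟨d', hd'⟩ : ∃ d' : ℝ → ℝ, d' = fun y =>
    (ζ₂ ^ 2 * Real.exp (ζ₂ * y) - ζ₁ ^ 2 * Real.exp (ζ₁ * y)) / (ζ₂ - ζ₁) := ⟨_, rfl⟩
  have hψd : ∀ y, HasDerivAt ψ (d y) y := fun y => by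
    rw [funext hψ, hd]
    exact (((hasStrictDerivAt_exp_const_mul ζ₂ y).sub
      (hasStrictDerivAt_exp_const_mul ζ₁ y)).div_const _).hasDerivAt
  have hdd : ∀ y, HasStrictDerivAt d (d' y) y := fun y => by
    rw [hd, hd']
    refine ((((hasStrictDerivAt_exp_const_mul ζ₂ y).const_mul ζ₂).sub
      ((hasStrictDerivAt_exp_const_mul ζ₁ y).const_mul ζ₁)).div_const _).congr_deriv ?_
    ring
  have hψ_deriv : deriv ψ = d := funext fun y => (hψd y).deriv
  have hd_pos : ∀ y, 0 < d y := fun y => by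
    rw [hd]
    have h₁ := mul_neg_of_neg_of_pos hneg (Real.exp_pos (ζ₁ * y))
    have h₂ := mul_pos hpos (Real.exp_pos (ζ₂ * y))
    exact div_pos (by linarith) hsub
  have hd'_neg : ∀ y < B, d' y < 0 := fun y hy => by
    rw [hd']
    rw [hB] at hy
    exact div_neg_of_neg_of_pos
      (sub_neg.2 (sq_mul_exp_lt_sq_mul_exp hneg.ne hpos.ne' hlt hy)) hsub
  have hψ_pos : ∀ y, 0 < y → 0 < ψ y := fun y hy => by
    rw [hψ]
    exact div_pos (sub_pos.2 (Real.exp_lt_exp.2 (mul_lt_mul_of_pos_right hlt hy))) hsub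
  have hd_anti : StrictAntiOn d (Iic B) := by
    refine strictAntiOn_of_deriv_neg (convex_Iic B)
      (fun y _ => (hdd y).hasDerivAt.continuousAt.continuousWithinAt) fun y hy => ?_
    rw [interior_Iic] at hy
    rw [(hdd y).hasDerivAt.deriv]
    exact hd'_neg y hy
  rw [hψ_deriv] at hV₁ hlam ⊢
  have hVd : ∀ y ≤ B, deriv V y = d y / d B := fun y hy => by
    rcases eq_or_lt_of_le hy with rfl | hyB
    · rw [div_self (hd_pos y).ne']
      refine (hasDerivAt_of_affine_continuation (g := fun z => ψ z / d y) ?_ hV₁ ?_).deriv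
      · simpa [div_self (hd_pos y).ne'] using (hψd y).div_const (d y)
      · simpa using hV₂
    · refine (((hψd y).div_const (d B)).congr_of_eventuallyEq ?_).deriv
      filter_upwards [Iio_mem_nhds hyB] with z hz using hV₁ z (le_of_lt hz)
  have hc : ∀ y ∈ Icc 0 B, c y = 1 - d B / d y := fun y hy => by
    have h₁ := (hd_pos y).ne'
    have h₂ := (hd_pos B).ne'
    rw [hc₁ y hy.1 hy.2, hVd y hy.2]
    field_simp
  have hc_anti : StrictAntiOn c (Icc 0 B) := fun y hy z hz hyz => by
    rw [hc y hy, hc z hz]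
    exact sub_lt_sub_left (div_lt_div_of_pos_left (hd_pos B) (hd_pos z) (hd_anti hy.2 hz.2 hyz)) 1
  intro x hx
  have hB0 : 0 ≤ B := (hx.1.trans hx.2).le
  have hcB : c B = 0 := by rw [hc B ⟨hB0, le_rfl⟩, div_self (hd_pos B).ne', sub_self]
  have hc0 : c 0 = phat := by rw [hphat, hc₁ 0 le_rfl hB0]
  have hc_mem : ∀ y ∈ Ioo 0 B, c y ∈ Ioo 0 phat := fun y hy => by
    have hy' := Ioo_subset_Icc_self hy
    exact ⟨hcB ▸ hc_anti hy' ⟨hB0, le_rfl⟩ hy.2, hc0 ▸ hc_anti ⟨le_rfl, hB0⟩ hy' hy.1⟩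
  have hbc : ∀ y ∈ Ioo 0 B, b (c y) = y := fun y hy => by
    obtain ⟨h₁, h₂⟩ := hb₁ (c y) (hc_mem y hy).1.le (hc_mem y hy).2.le
    exact hc_anti.injOn h₁ (Ioo_subset_Icc_self hy) h₂
  have hx0 : x ≠ 0 := hx.1.ne'
  have hψx : ψ x ≠ 0 := (hψ_pos x hx.1).ne'
  have hdx : d x ≠ 0 := (hd_pos x).ne'
  have hnhds : Ioo 0 B ∈ 𝓝 x := Ioo_mem_nhds hx.1 hx.2
  obtain ⟨c', hc'_ne, hc'⟩ : ∃ c' : ℝ, c' ≠ 0 ∧ HasStrictDerivAt c c' x := by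
    refine ⟨d B * d' x / d x ^ 2, div_ne_zero
      (mul_ne_zero (hd_pos B).ne' (hd'_neg x hx.2).ne) (pow_ne_zero 2 hdx), ?_⟩
    refine (hasStrictDerivAt_one_sub_div (hdd x) hdx).congr_of_eventuallyEq ?_
    filter_upwards [hnhds] with y hy using (hc y (Ioo_subset_Icc_self hy)).symm
  have hb' : HasDerivAt b c'⁻¹ (c x) := by
    refine (hc'.to_local_left_inverse hc'_ne ?_).hasDerivAt
    filter_upwards [hnhds] with y hy using hbc y hy
  have hbx := hbc x hx
  have hcx := hc_mem x hx
  have hux : derivWithin (fun z => u z (c x)) (Iic (b (c x))) x = x * d x / ψ x := by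
    rw [hbx]
    have h : HasDerivWithinAt (fun z => x * ψ z / ψ x) (x * d x / ψ x) (Iic x) x :=
      (((hψd x).const_mul x).div_const (ψ x)).hasDerivWithinAt
    refine (h.congr_of_eventuallyEq_of_mem ?_ self_mem_Iic).derivWithin
      (uniqueDiffOn_Iic x x self_mem_Iic)
    filter_upwards [self_mem_nhdsWithin,
      mem_nhdsWithin_of_mem_nhds (Ioi_mem_nhds hx.1)] with z hz hz0
    rw [hu z (c x) hz0 (hbx.symm ▸ hz) hcx.1 hcx.2, hbx]
  have hup : derivWithin (fun q => u x q) (Iic (c x)) (c x) = (ψ x - x * d x) / (ψ x * c') := by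
    have h : HasDerivAt (fun q => b q * ψ x / ψ (b q)) ((ψ x - x * d x) / (ψ x * c')) (c x) := by
      have hψb : HasDerivAt (fun q => ψ (b q)) (d x * c'⁻¹) (c x) :=
        HasDerivAt.comp (c x) (hbx.symm ▸ hψd x) hb'
      refine ((hb'.mul_const (ψ x)).div hψb (by rwa [hbx])).congr_deriv ?_
      rw [hbx]
      field_simp
    refine (h.hasDerivWithinAt.congr_of_eventuallyEq_of_mem ?_ self_mem_Iic).derivWithin
      (uniqueDiffOn_Iic _ _ self_mem_Iic)
    filter_upwards [self_mem_nhdsWithin,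
      mem_nhdsWithin_of_mem_nhds (Ioi_mem_nhds hcx.1)] with q hq hq0
    have hq' : q < phat := lt_of_le_of_lt hq hcx.2
    obtain ⟨h₁, h₂⟩ := hb₁ q (le_of_lt hq0) hq'.le
    refine hu x q hx.1 ?_ hq0 hq'
    rw [← hc_anti.le_iff_ge h₁ (Ioo_subset_Icc_self hx), h₂]
    exact hq
  rw [hux, hup, hc'.hasDerivAt.deriv, hlam x hx.1 hx.2.le]
  refine ⟨rfl, by rwa [one_div], rfl, ?_, ?_⟩ <;> field_simp
end

section
/- For every p ∈ (0, p̂) and every y ∈ [b(p), B], setting q = c(y) (so that q ≤ p and y = b(q)), one has (q(1−p)/p) V(y) ≤ (1−p)V(b(p)) + (y − b(p)). Consequently, for any x ≥ y, (q(1−p)/p) V(b(q)) + (x − y) ≤ (1−p)V(b(p)) + (x − b(p)); i.e., an initial lump-sum extraction to a level strictly between b(p) and the initial level is suboptimal for Player 1 against the equilibrium strategy of Player 2. -/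
theorem quadratic_roots_sign {μ σ r ζ₁ ζ₂ : ℝ} (hμ : 0 < μ) (hσ : 0 < σ) (hr : 0 < r)
    (hζ₁ : ζ₁ = (-μ - Real.sqrt (μ ^ 2 + 2 * r * σ ^ 2)) / σ ^ 2)
    (hζ₂ : ζ₂ = (-μ + Real.sqrt (μ ^ 2 + 2 * r * σ ^ 2)) / σ ^ 2) :
    ζ₁ < 0 ∧ 0 < ζ₂ ∧ ζ₂ < -ζ₁ := by
  have hσ2 : 0 < σ ^ 2 := by positivity
  have hs : μ < Real.sqrt (μ ^ 2 + 2 * r * σ ^ 2) :=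
    Real.lt_sqrt_of_sq_lt (lt_add_of_pos_right _ (by positivity))
  refine ⟨?_, ?_, ?_⟩
  · rw [hζ₁]
    exact div_neg_of_neg_of_pos (by linarith) hσ2
  · rw [hζ₂]
    exact div_pos (by linarith) hσ2
  · rw [hζ₁, hζ₂, ← neg_div]
    exact div_lt_div_of_pos_right (by linarith) hσ2

theorem hasDerivAt_const_mul_exp_mul (k a y : ℝ) :
    HasDerivAt (fun t => k * Real.exp (a * t)) (k * a * Real.exp (a * y)) y := by
  have h := (((hasDerivAt_id y).const_mul a).exp).const_mul k
  simp only [id_eq, mul_one] at h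
  exact h.congr_deriv (by ring)

theorem hasDerivAt_expDiff (ζ₁ ζ₂ y : ℝ) :
    HasDerivAt (fun t => (Real.exp (ζ₂ * t) - Real.exp (ζ₁ * t)) / (ζ₂ - ζ₁))
      ((ζ₂ * Real.exp (ζ₂ * y) - ζ₁ * Real.exp (ζ₁ * y)) / (ζ₂ - ζ₁)) y := by
  have h := ((hasDerivAt_const_mul_exp_mul 1 ζ₂ y).sub
    (hasDerivAt_const_mul_exp_mul 1 ζ₁ y)).div_const (ζ₂ - ζ₁)
  simpa only [one_mul, Pi.sub_def] using h

theorem strictAntiOn_deriv_expDiff {ζ₁ ζ₂ B : ℝ} (h₁ : ζ₁ < 0) (h₂ : 0 < ζ₂)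
    (hB : B = (Real.log (ζ₁ ^ 2) - Real.log (ζ₂ ^ 2)) / (ζ₂ - ζ₁)) :
    StrictAntiOn
      (fun y => (ζ₂ * Real.exp (ζ₂ * y) - ζ₁ * Real.exp (ζ₁ * y)) / (ζ₂ - ζ₁))
      (Set.Iic B) := by
  have hd : 0 < ζ₂ - ζ₁ := by linarith
  have hder : ∀ y, HasDerivAt
      (fun y => (ζ₂ * Real.exp (ζ₂ * y) - ζ₁ * Real.exp (ζ₁ * y)) / (ζ₂ - ζ₁))
      ((ζ₂ * ζ₂ * Real.exp (ζ₂ * y) - ζ₁ * ζ₁ * Real.exp (ζ₁ * y)) / (ζ₂ - ζ₁)) y := fun y =>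
    ((hasDerivAt_const_mul_exp_mul ζ₂ ζ₂ y).sub
      (hasDerivAt_const_mul_exp_mul ζ₁ ζ₁ y)).div_const _
  refine strictAntiOn_of_deriv_neg (convex_Iic B)
    (fun y _ => (hder y).continuousAt.continuousWithinAt) fun y hy => ?_
  rw [interior_Iic, Set.mem_Iio, hB, lt_div_iff₀ hd] at hy
  rw [(hder y).deriv]
  refine div_neg_of_neg_of_pos (sub_neg.2 ?_) hd
  rw [← sq, ← sq, ← Real.exp_log (show 0 < ζ₂ ^ 2 by positivity),
    ← Real.exp_log (show 0 < ζ₁ ^ 2 from sq_pos_of_neg h₁), ← Real.exp_add, ← Real.exp_add,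
    Real.exp_lt_exp]
  linarith

/-- A differentiable function continued beyond `B` by a line whose slope is its derivative at `B`
keeps its derivative on `(-∞, B]`. -/
theorem hasDerivAt_of_linear_continuation {f V f' : ℝ → ℝ} {B : ℝ}
    (hf : ∀ y, HasDerivAt f (f' y) y) (h₁ : ∀ y ≤ B, V y = f y)
    (h₂ : ∀ y, B < y → V y = y - B + V B) (hB : f' B = 1) {y : ℝ} (hy : y ≤ B) :
    HasDerivAt V (f' y) y := by
  rcases hy.lt_or_eq with hlt | rfl
  · refine (hf y).congr_of_eventuallyEq ?_
    filter_upwards [Iio_mem_nhds hlt] with t ht using h₁ t ht.le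
  · have hl : HasDerivWithinAt V (f' y) (Set.Iic y) y :=
      (hf y).hasDerivWithinAt.congr (fun t ht => h₁ t ht) (h₁ y le_rfl)
    have hline : HasDerivAt (fun t => t - y + V y) (f' y) y := by
      rw [hB]
      exact ((hasDerivAt_id y).sub_const y).add_const (V y)
    have hr : HasDerivWithinAt V (f' y) (Set.Ici y) y := by
      refine hline.hasDerivWithinAt.congr (fun t ht => ?_) (by ring)
      rcases (Set.mem_Ici.1 ht).eq_or_lt with rfl | h
      · ring
      · exact h₂ t h
    simpa using hl.union hr

/-- A function whose derivative is antitone on `(-∞, B]` lies below its tangent lines there. -/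
theorem le_tangent_of_antitoneOn_deriv {V D : ℝ → ℝ} {B a y : ℝ}
    (hV : ∀ t ≤ B, HasDerivAt V (D t) t) (hD : AntitoneOn D (Set.Iic B))
    (hay : a ≤ y) (hy : y ≤ B) : V y ≤ V a + D a * (y - a) := by
  have h := (convex_Icc a y).image_sub_le_mul_sub_of_deriv_le (f := V) (C := D a)
    (fun t ht => (hV t (ht.2.trans hy)).continuousAt.continuousWithinAt)
    (fun t ht => (hV t ((interior_subset ht).2.trans hy)).differentiableAt.differentiableWithinAt)
    (fun t ht => by
      have ht' := interior_subset ht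
      rw [(hV t (ht'.2.trans hy)).deriv]
      exact hD (hay.trans hy) (ht'.2.trans hy) ht'.1)
    a (Set.left_mem_Icc.2 hay) y (Set.right_mem_Icc.2 hay) hay
  linarith


/-- For every `p ∈ (0, p̂)` and `y ∈ [b(p), B]`, setting `q = c(y)`
(so that `q ≤ p` and `y = b(q)`), one has
`(q(1−p)/p) V(y) ≤ (1−p)V(b(p)) + (y − b(p))`, and consequently for any `x ≥ y`,
`(q(1−p)/p) V(b(q)) + (x − y) ≤ (1−p)V(b(p)) + (x − b(p))`: an initial lump-sum extraction
to a level strictly between `b(p)` and the initial level is suboptimal for Player 1 against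
the equilibrium strategy of Player 2. -/
theorem deFinetti_lump_sum_intermediate_suboptimal
    (μ σ r : ℝ) (hμ : 0 < μ) (hσ : 0 < σ) (hr : 0 < r)
    (ζ₁ ζ₂ : ℝ)
    (hζ₁ : ζ₁ = (-μ - Real.sqrt (μ ^ 2 + 2 * r * σ ^ 2)) / σ ^ 2)
    (hζ₂ : ζ₂ = (-μ + Real.sqrt (μ ^ 2 + 2 * r * σ ^ 2)) / σ ^ 2)
    (ψ : ℝ → ℝ)
    (hψ : ∀ y : ℝ, ψ y = (Real.exp (ζ₂ * y) - Real.exp (ζ₁ * y)) / (ζ₂ - ζ₁))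
    (B : ℝ) (hB : B = (Real.log (ζ₁ ^ 2) - Real.log (ζ₂ ^ 2)) / (ζ₂ - ζ₁))
    (V : ℝ → ℝ)
    (hV₁ : ∀ y : ℝ, y ≤ B → V y = ψ y / deriv ψ B)
    (hV₂ : ∀ y : ℝ, B < y → V y = y - B + V B)
    (c : ℝ → ℝ)
    (hc₁ : ∀ y : ℝ, 0 ≤ y → y ≤ B → c y = (deriv V y - 1) / deriv V y)
    (hc₂ : ∀ y : ℝ, B < y → c y = 0)
    (phat : ℝ) (hphat : phat = (deriv V 0 - 1) / deriv V 0)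
    (b : ℝ → ℝ)
    (hb₁ : ∀ q : ℝ, 0 ≤ q → q ≤ phat → b q ∈ Set.Icc 0 B ∧ c (b q) = q)
    (hb₂ : ∀ q : ℝ, phat < q → q ≤ 1 → b q = 0) :
    ∀ p ∈ Set.Ioo (0 : ℝ) phat, ∀ y : ℝ, b p ≤ y → y ≤ B →
      c y ≤ p ∧ y = b (c y) ∧
      (c y * (1 - p) / p) * V y ≤ (1 - p) * V (b p) + (y - b p) ∧
      (∀ x : ℝ, y ≤ x →
        (c y * (1 - p) / p) * V (b (c y)) + (x - y)
          ≤ (1 - p) * V (b p) + (x - b p)) := by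
  obtain ⟨h₁, h₂, h₁₂⟩ := quadratic_roots_sign hμ hσ hr hζ₁ hζ₂
  have hd : 0 < ζ₂ - ζ₁ := by linarith
  have hB0 : 0 ≤ B := by
    rw [hB]
    refine div_nonneg (sub_nonneg.2 (Real.log_le_log (by positivity) ?_)) hd.le
    nlinarith
  have hψ' := hasDerivAt_expDiff ζ₁ ζ₂
  rw [← funext hψ] at hψ'
  have hanti := strictAntiOn_deriv_expDiff h₁ h₂ hB
  set g : ℝ → ℝ := fun y => (ζ₂ * Real.exp (ζ₂ * y) - ζ₁ * Real.exp (ζ₁ * y)) / (ζ₂ - ζ₁)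
  have hgB : 0 < g B := by
    refine div_pos ?_ hd
    have := mul_pos h₂ (Real.exp_pos (ζ₂ * B))
    have := mul_pos (neg_pos.2 h₁) (Real.exp_pos (ζ₁ * B))
    linarith
  rw [(hψ' B).deriv] at hV₁
  have hDB : g B / g B = 1 := div_self hgB.ne'
  have hV : ∀ y ≤ B, HasDerivAt V (g y / g B) y := fun y hy =>
    hasDerivAt_of_linear_continuation (f' := fun t => g t / g B)
      (fun t => (hψ' t).div_const (g B)) hV₁ hV₂ hDB hy
  have hDanti : StrictAntiOn (fun t => g t / g B) (Set.Iic B) := fun s hs t ht hst =>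
    div_lt_div_of_pos_right (hanti hs ht hst) hgB
  set D : ℝ → ℝ := fun t => g t / g B
  have hD1 : ∀ y ≤ B, 1 ≤ D y := fun y hy => by
    rw [← hDB]
    exact hDanti.antitoneOn hy Set.self_mem_Iic hy
  have hc : ∀ y, 0 ≤ y → y ≤ B → c y = 1 - (D y)⁻¹ := fun y hy0 hy => by
    have hpos : 0 < D y := one_pos.trans_le (hD1 y hy)
    rw [hc₁ y hy0 hy, (hV y hy).deriv]
    change (D y - 1) / D y = _
    field_simp
  have hcanti : StrictAntiOn c (Set.Icc 0 B) := fun s hs t ht hst => by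
    rw [hc s hs.1 hs.2, hc t ht.1 ht.2]
    have := inv_strictAnti₀ (one_pos.trans_le (hD1 t ht.2)) (hDanti hs.2 ht.2 hst)
    linarith
  have hphat0 : phat = c 0 := by rw [hphat, hc₁ 0 le_rfl hB0]
  intro p hp y hby hyB
  obtain ⟨hbp, hcbp⟩ := hb₁ p hp.1.le hp.2.le
  have hy : y ∈ Set.Icc 0 B := ⟨hbp.1.trans hby, hyB⟩
  have hcp : c y ≤ p := by
    rw [← hcbp]
    exact hcanti.antitoneOn hbp hy hby
  have hcy0 : 0 ≤ c y := by
    rw [hc y hy.1 hyB]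
    exact sub_nonneg.2 (inv_le_one_of_one_le₀ (hD1 y hyB))
  obtain ⟨hbcy, hcbcy⟩ := hb₁ (c y) hcy0 (hcp.trans hp.2.le)
  have hybc : y = b (c y) := (hcanti.injOn hbcy hy hcbcy).symm
  have hDpos : 0 < D (b p) := one_pos.trans_le (hD1 _ hbp.2)
  have hp1 : 1 - p = (D (b p))⁻¹ := by
    have := hc (b p) hbp.1 hbp.2
    linarith
  have hp0 : 0 < 1 - p := by
    rw [hp1]
    exact inv_pos.2 hDpos
  have hVy : 0 ≤ V y := by
    rw [hV₁ y hyB, hψ]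
    refine div_nonneg (div_nonneg (sub_nonneg.2 (Real.exp_le_exp.2 ?_)) hd.le) hgB.le
    exact mul_le_mul_of_nonneg_right (by linarith) hy.1
  have hmain : (c y * (1 - p) / p) * V y ≤ (1 - p) * V (b p) + (y - b p) :=
    calc (c y * (1 - p) / p) * V y ≤ (1 - p) * V y := by
          refine mul_le_mul_of_nonneg_right ?_ hVy
          rw [div_le_iff₀ hp.1, mul_comm (1 - p)]
          exact mul_le_mul_of_nonneg_right hcp hp0.le
      _ ≤ (1 - p) * (V (b p) + D (b p) * (y - b p)) :=
          mul_le_mul_of_nonneg_left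
            (le_tangent_of_antitoneOn_deriv hV hDanti.antitoneOn hby hyB) hp0.le
      _ = (1 - p) * V (b p) + (y - b p) := by
          rw [mul_add, ← mul_assoc, hp1, inv_mul_cancel₀ hDpos.ne', one_mul]
  refine ⟨hcp, hybc, hmain, fun x _ => ?_⟩
  rw [← hybc]
  linarith
end

section
/- (Pathwise version of Remark 5.2.) For every t ≥ 0 such that sup_{0≤s≤t} Y_s ≥ Λ(B) + B, one has X̄_t = B and hence Π_t := min(p, c(X̄_t)) = 0; that is, the belief process reaches 0 as soon as the unrestricted path Y reaches the level Λ(B) + B. -/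
/-- The `r`-scale function of a Brownian motion with drift, with exponents `a < 0 < d`. -/
noncomputable def scaleFun (a d y : ℝ) : ℝ :=
  (Real.exp (d * y) - Real.exp (a * y)) / (d - a)

/-- The derivative of `scaleFun a d`. -/
noncomputable def scaleFunDeriv (a d y : ℝ) : ℝ :=
  (d * Real.exp (d * y) - a * Real.exp (a * y)) / (d - a)

theorem hasDerivAt_exp_const_mul (k y : ℝ) :
    HasDerivAt (fun z => Real.exp (k * z)) (k * Real.exp (k * y)) y := by
  simpa [mul_comm] using ((hasDerivAt_id y).const_mul k).exp

theorem hasDerivAt_scaleFun (a d y : ℝ) :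
    HasDerivAt (scaleFun a d) (scaleFunDeriv a d y) y :=
  ((hasDerivAt_exp_const_mul d y).sub (hasDerivAt_exp_const_mul a y)).div_const _

theorem hasDerivAt_scaleFunDeriv (a d y : ℝ) :
    HasDerivAt (scaleFunDeriv a d)
      ((d * (d * Real.exp (d * y)) - a * (a * Real.exp (a * y))) / (d - a)) y :=
  (((hasDerivAt_exp_const_mul d y).const_mul d).sub
    ((hasDerivAt_exp_const_mul a y).const_mul a)).div_const _

theorem deriv_scaleFun (a d : ℝ) : deriv (scaleFun a d) = scaleFunDeriv a d :=
  funext fun y => (hasDerivAt_scaleFun a d y).deriv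

theorem differentiable_scaleFun (a d : ℝ) : Differentiable ℝ (scaleFun a d) :=
  fun y => (hasDerivAt_scaleFun a d y).differentiableAt

theorem differentiable_scaleFunDeriv (a d : ℝ) : Differentiable ℝ (scaleFunDeriv a d) :=
  fun y => (hasDerivAt_scaleFunDeriv a d y).differentiableAt

theorem scaleFun_zero (a d : ℝ) : scaleFun a d 0 = 0 := by simp [scaleFun]

theorem scaleFunDeriv_pos {a d : ℝ} (ha : a < 0) (hd : 0 < d) (y : ℝ) :
    0 < scaleFunDeriv a d y := by
  have h₁ := mul_pos hd (Real.exp_pos (d * y))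
  have h₂ := mul_neg_of_neg_of_pos ha (Real.exp_pos (a * y))
  exact div_pos (by linarith) (by linarith)

/-- `scaleFun a d` is concave to the left of its inflection point. -/
theorem antitoneOn_scaleFunDeriv {a d : ℝ} (ha : a < 0) (hd : 0 < d) :
    AntitoneOn (scaleFunDeriv a d)
      (Set.Iic ((Real.log (a ^ 2) - Real.log (d ^ 2)) / (d - a))) := by
  refine antitoneOn_of_deriv_nonpos (convex_Iic _)
    (differentiable_scaleFunDeriv a d).continuous.continuousOn
    (differentiable_scaleFunDeriv a d).differentiableOn fun y hy => ?_
  rw [interior_Iic, Set.mem_Iio, lt_div_iff₀ (by linarith)] at hy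
  rw [(hasDerivAt_scaleFunDeriv a d y).deriv]
  refine div_nonpos_of_nonpos_of_nonneg ?_ (by linarith)
  have ha2 : 0 < a ^ 2 := sq_pos_of_neg ha
  have hd2 : 0 < d ^ 2 := by positivity
  have h : Real.exp (Real.log (d ^ 2) + d * y) ≤ Real.exp (Real.log (a ^ 2) + a * y) :=
    Real.exp_le_exp.2 (by linarith)
  rw [Real.exp_add, Real.exp_add, Real.exp_log ha2, Real.exp_log hd2] at h
  linarith

/-- The tangent inequality at the origin for the concave part of `scaleFun a d`. -/
theorem mul_scaleFunDeriv_le_scaleFun {a d y : ℝ} (ha : a < 0) (hd : 0 < d) (hy : 0 < y)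
    (hyB : y ≤ (Real.log (a ^ 2) - Real.log (d ^ 2)) / (d - a)) :
    y * scaleFunDeriv a d y ≤ scaleFun a d y := by
  obtain ⟨z, hz, hzy⟩ := exists_hasDerivAt_eq_slope (scaleFun a d) (scaleFunDeriv a d) hy
    (differentiable_scaleFun a d).continuous.continuousOn
    fun z _ => hasDerivAt_scaleFun a d z
  have h := antitoneOn_scaleFunDeriv ha hd (hz.2.le.trans hyB) hyB hz.2.le
  rw [hzy, scaleFun_zero, sub_zero, sub_zero, le_div_iff₀ hy] at h
  linarith

/-- A function agreeing with `ψ / (y ψ') - 1` on `(0, B]`, for a scale function `ψ`, is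
integrable there: the quotient `ψ / y` extends continuously to the origin. -/
theorem intervalIntegrable_scaleFun_ratio {a d : ℝ} (ha : a < 0) (hd : 0 < d) {B : ℝ}
    (hB : 0 ≤ B) {lam : ℝ → ℝ}
    (hlam : ∀ y, 0 < y → y ≤ B → lam y = scaleFun a d y / (y * scaleFunDeriv a d y) - 1) :
    IntervalIntegrable lam MeasureTheory.volume 0 B := by
  have hcont : Continuous fun y => dslope (scaleFun a d) 0 y / scaleFunDeriv a d y - 1 := by
    refine (Continuous.div ?_ (differentiable_scaleFunDeriv a d).continuous
      fun y => (scaleFunDeriv_pos ha hd y).ne').sub continuous_const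
    rw [← continuousOn_univ, continuousOn_dslope Filter.univ_mem]
    exact ⟨(differentiable_scaleFun a d).continuous.continuousOn, differentiable_scaleFun a d 0⟩
  refine (hcont.intervalIntegrable 0 B).congr fun y hy => ?_
  rw [Set.uIoc_of_le hB] at hy
  rw [hlam y hy.1 hy.2, dslope_of_ne _ hy.1.ne', slope_def_field, scaleFun_zero, sub_zero,
    sub_zero, div_div]

/-- Extending a function beyond `B` by its tangent line at `B` keeps it
differentiable at `B`, with the same derivative. -/
theorem hasDerivAt_of_glue_affine {g V : ℝ → ℝ} {B m : ℝ} (hg : HasDerivAt g m B)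
    (hle : ∀ y, y ≤ B → V y = g y) (hlt : ∀ y, B < y → V y = m * (y - B) + V B) :
    HasDerivAt V m B := by
  have hleft : HasDerivWithinAt V m (Set.Iic B) B :=
    hg.hasDerivWithinAt.congr hle (hle B le_rfl)
  have hright : HasDerivWithinAt V m (Set.Ici B) B := by
    have h : HasDerivAt (fun y => m * (y - B) + V B) m B := by
      simpa using (((hasDerivAt_id B).sub_const B).const_mul m).add_const (V B)
    refine h.hasDerivWithinAt.congr (fun y hy => ?_) (by simp)
    rcases (Set.mem_Ici.1 hy).eq_or_lt with rfl | hy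
    · simp
    · exact hlt y hy
  simpa using hleft.union hright

/-- If `Y` is reflected at the running maximum through `f ≤ B`, then the running maximum of the
resulting path is `B` as soon as `f` takes the value `B` at the running maximum of `Y`. -/
theorem sSup_image_eq_of_running_max {Y Ybar X f : ℝ → ℝ} {β B t : ℝ} (hY : Continuous Y)
    (hYbar : ∀ s, Ybar s = max β (sSup (Y '' Set.Icc 0 s)))
    (hX : ∀ s, X s = Y s - Ybar s + f (Ybar s)) (hf : ∀ y, β ≤ y → f y ≤ B)
    (ht : 0 ≤ t) (hβ : β ≤ sSup (Y '' Set.Icc 0 t))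
    (hfB : f (sSup (Y '' Set.Icc 0 t)) = B) :
    sSup (X '' Set.Icc 0 t) = B := by
  have hbdd (s : ℝ) : BddAbove (Y '' Set.Icc 0 s) := (isCompact_Icc.image hY).bddAbove
  have hle : ∀ s, 0 ≤ s → X s ≤ B := fun s hs => by
    have h₁ : Y s ≤ Ybar s := by
      rw [hYbar]
      exact le_max_of_le_right (le_csSup (hbdd s) ⟨s, ⟨hs, le_rfl⟩, rfl⟩)
    have h₂ := hf (Ybar s) (by rw [hYbar]; exact le_max_left _ _)
    rw [hX]
    linarith
  obtain ⟨s, hs, hsY⟩ := (isCompact_Icc.image hY).sSup_mem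
    ((Set.nonempty_Icc.2 ht).image Y)
  have hmax : sSup (Y '' Set.Icc 0 s) = sSup (Y '' Set.Icc 0 t) := by
    refine le_antisymm (csSup_le_csSup (hbdd t) ⟨_, s, ⟨hs.1, le_rfl⟩, rfl⟩
      (Set.image_mono (Set.Icc_subset_Icc_right hs.2))) ?_
    rw [← hsY]
    exact le_csSup (hbdd s) ⟨s, ⟨hs.1, le_rfl⟩, rfl⟩
  have hXs : X s = B := by
    rw [hX, hYbar, hmax, max_eq_right hβ, hsY, hfB]
    ring
  refine IsGreatest.csSup_eq ⟨⟨s, hs, hXs⟩, ?_⟩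
  rintro _ ⟨u, hu, rfl⟩
  exact hle u hu.1


/-- pathwise version of Remark 5.2. For every `t ≥ 0` such that
`sup_{0≤s≤t} Y_s ≥ Λ(B) + B`, one has `X̄_t = B` and hence the belief
`Π_t = min(p, c(X̄_t)) = 0`: the belief process reaches `0` as soon as the unrestricted
path `Y` reaches the level `Λ(B) + B`. -/
theorem deFinetti_belief_hits_zero
    (μ σ r : ℝ) (hμ : 0 < μ) (hσ : 0 < σ) (hr : 0 < r)
    (ζ₁ ζ₂ : ℝ)
    (hζ₁ : ζ₁ = (-μ - Real.sqrt (μ ^ 2 + 2 * r * σ ^ 2)) / σ ^ 2)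
    (hζ₂ : ζ₂ = (-μ + Real.sqrt (μ ^ 2 + 2 * r * σ ^ 2)) / σ ^ 2)
    (ψ : ℝ → ℝ)
    (hψ : ∀ y : ℝ, ψ y = (Real.exp (ζ₂ * y) - Real.exp (ζ₁ * y)) / (ζ₂ - ζ₁))
    (B : ℝ) (hB : B = (Real.log (ζ₁ ^ 2) - Real.log (ζ₂ ^ 2)) / (ζ₂ - ζ₁))
    (V : ℝ → ℝ)
    (hV₁ : ∀ y : ℝ, y ≤ B → V y = ψ y / deriv ψ B)
    (hV₂ : ∀ y : ℝ, B < y → V y = y - B + V B)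
    (c : ℝ → ℝ)
    (hc₁ : ∀ y : ℝ, 0 ≤ y → y ≤ B → c y = (deriv V y - 1) / deriv V y)
    (hc₂ : ∀ y : ℝ, B < y → c y = 0)
    (phat : ℝ) (hphat : phat = (deriv V 0 - 1) / deriv V 0)
    (b : ℝ → ℝ)
    (hb₁ : ∀ q : ℝ, 0 ≤ q → q ≤ phat → b q ∈ Set.Icc 0 B ∧ c (b q) = q)
    (hb₂ : ∀ q : ℝ, phat < q → q ≤ 1 → b q = 0)
    (lam : ℝ → ℝ)
    (hlam : ∀ y : ℝ, 0 < y → y ≤ B → lam y = ψ y / (y * deriv ψ y) - 1)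
    (p : ℝ) (hp : p ∈ Set.Icc (0 : ℝ) 1)
    (Lam : ℝ → ℝ)
    (hLam : ∀ y : ℝ, b p ≤ y → y ≤ B → Lam y = ∫ z in (b p)..y, lam z)
    (f : ℝ → ℝ)
    (hf₁ : ∀ y : ℝ, b p ≤ y → y ≤ Lam B + B →
      f y ∈ Set.Icc (b p) B ∧ Lam (f y) + f y = y)
    (hf₂ : ∀ y : ℝ, Lam B + B < y → f y = B)
    (x : ℝ) (hx : x ∈ Set.Icc 0 (b p))
    (Y : ℝ → ℝ) (hYcont : Continuous Y) (hY0 : Y 0 = x)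
    (Ybar : ℝ → ℝ)
    (hYbar : ∀ t : ℝ, Ybar t = max (b p) (sSup (Y '' Set.Icc 0 t)))
    (X : ℝ → ℝ)
    (hX : ∀ t : ℝ, X t = Y t - Ybar t + f (Ybar t))
    (Xbar : ℝ → ℝ)
    (hXbar : ∀ t : ℝ, Xbar t = max (b p) (sSup (X '' Set.Icc 0 t))) :
    ∀ t : ℝ, 0 ≤ t → Lam B + B ≤ sSup (Y '' Set.Icc 0 t) →
      Xbar t = B ∧ min p (c (Xbar t)) = 0 := by
  have hσ2 : 0 < σ ^ 2 := by positivity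
  have hsqrt : μ < Real.sqrt (μ ^ 2 + 2 * r * σ ^ 2) :=
    Real.lt_sqrt_of_sq_lt (by nlinarith [mul_pos hr hσ2])
  have hneg : ζ₁ < 0 := by rw [hζ₁]; exact div_neg_of_neg_of_pos (by linarith) hσ2
  have hpos : 0 < ζ₂ := by rw [hζ₂]; exact div_pos (by linarith) hσ2
  have hsum : ζ₁ + ζ₂ < 0 := by
    rw [hζ₁, hζ₂, ← add_div]; exact div_neg_of_neg_of_pos (by linarith) hσ2
  have hB0 : 0 ≤ B := by
    rw [hB]
    refine div_nonneg (sub_nonneg.2 (Real.log_le_log (by positivity) ?_)) (by linarith)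
    nlinarith
  obtain rfl : ψ = scaleFun ζ₁ ζ₂ := funext hψ
  simp only [deriv_scaleFun] at hV₁ hlam
  have hVB : deriv V B = 1 := by
    refine (hasDerivAt_of_glue_affine ?_ hV₁ fun y hy => by rw [one_mul]; exact hV₂ y hy).deriv
    simpa [div_self (scaleFunDeriv_pos hneg hpos B).ne'] using
      (hasDerivAt_scaleFun ζ₁ ζ₂ B).div_const (scaleFunDeriv ζ₁ ζ₂ B)
  have hcB : c B = 0 := by rw [hc₁ B hB0 le_rfl, hVB]; simp
  have hbp : b p ∈ Set.Icc 0 B := by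
    rcases le_or_gt p phat with h | h
    · exact (hb₁ p hp.1 h).1
    · rw [hb₂ p h hp.2]
      exact ⟨le_rfl, hB0⟩
  have hint := intervalIntegrable_scaleFun_ratio hneg hpos hB0 hlam
  have hlam0 : ∀ y, 0 < y → y ≤ B → 0 ≤ lam y := fun y hy hyB => by
    rw [hlam y hy hyB, sub_nonneg,
      one_le_div (mul_pos hy (scaleFunDeriv_pos hneg hpos y))]
    exact mul_scaleFunDeriv_le_scaleFun hneg hpos hy (hB ▸ hyB)
  have hmono : ∀ y, b p ≤ y → y ≤ B → Lam y ≤ Lam B := fun y hy hyB => by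
    have hsub {u v : ℝ} (hu : 0 ≤ u) (huv : u ≤ v) (hv : v ≤ B) :
        IntervalIntegrable lam MeasureTheory.volume u v :=
      hint.mono_set (by
        rw [Set.uIcc_of_le huv, Set.uIcc_of_le hB0]
        exact Set.Icc_subset_Icc hu hv)
    rw [hLam y hy hyB, hLam B hbp.2 le_rfl,
      ← intervalIntegral.integral_add_adjacent_intervals (hsub hbp.1 hy hyB)
        (hsub (hbp.1.trans hy) hyB le_rfl), le_add_iff_nonneg_right,
      intervalIntegral.integral_of_le hyB]
    exact MeasureTheory.setIntegral_nonneg measurableSet_Ioc fun z hz =>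
      hlam0 z ((hbp.1.trans hy).trans_lt hz.1) hz.2
  have hLamB : 0 ≤ Lam B := by
    simpa [hLam (b p) le_rfl hbp.2] using hmono (b p) le_rfl hbp.2
  have hfle : ∀ y, b p ≤ y → f y ≤ B := fun y hy => by
    rcases le_or_gt y (Lam B + B) with h | h
    · exact (hf₁ y hy h).1.2
    · exact (hf₂ y h).le
  intro t ht hsup
  have hbsup : b p ≤ sSup (Y '' Set.Icc 0 t) := by linarith [hbp.2]
  have hfB : f (sSup (Y '' Set.Icc 0 t)) = B := by
    rcases hsup.eq_or_lt with h | h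
    · obtain ⟨hmem, heq⟩ := hf₁ _ hbsup h.ge
      linarith [hmem.2, hmono _ hmem.1 hmem.2]
    · exact hf₂ _ h
  have hXB : Xbar t = B := by
    rw [hXbar, sSup_image_eq_of_running_max hYcont hYbar hX hfle ht hbsup hfB,
      max_eq_right hbp.2]
  exact ⟨hXB, by rw [hXB, hcB, min_eq_right hp.1]⟩
end
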